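/- arXiv:1803.02550 — 2 statements merged into one kernel-verified Lean document; each statement's English description precedes it below -/
import Mathlib

section
/- For every finite connected nonempty simple graph G of diameter d and radius r, the multipacking number satisfies mp(G) ≥ d/6 + r/3 − 3/2; equivalently, 6·mp(G) ≥ d + 2r − 9. -/
/-- A dominating broadcast: every vertex `u` is within distance `f v` of some vertex `v`
with `f v ≥ 1`. -/
def isDominatingBroadcast {V : Type*} (G : SimpleGraph V) (f : V → ℕ) : Prop :=
  ∀ u : V, ∃ v : V, 1 ≤ f v ∧ G.dist u v ≤ f v

/-- The broadcast number: minimum cost `∑ v, f v` of a dominating broadcast. -/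
noncomputable def broadcastNumber {V : Type*} [Fintype V] (G : SimpleGraph V) : ℕ :=
  sInf {c : ℕ | ∃ f : V → ℕ, isDominatingBroadcast G f ∧ ∑ v : V, f v = c}

/-- A multipacking: every ball of radius `r ≥ 1` contains at most `r` vertices of `P`. -/
def isMultipacking {V : Type*} (G : SimpleGraph V) (P : Set V) : Prop :=
  ∀ v : V, ∀ r : ℕ, 1 ≤ r → ({u ∈ P | G.dist u v ≤ r}).ncard ≤ r

/-- The multipacking number: maximum size of a multipacking. -/
noncomputable def multipackingNumber {V : Type*} [Fintype V] (G : SimpleGraph V) : ℕ :=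
  sSup {n : ℕ | ∃ P : Set V, isMultipacking G P ∧ P.ncard = n}

/-- The eccentricity of a vertex: the largest distance from it to any vertex. -/
noncomputable def eccentricity {V : Type*} [Fintype V] (G : SimpleGraph V) (v : V) : ℕ :=
  Finset.univ.sup fun u : V => G.dist u v

/-- The radius of a graph: the minimum eccentricity over all vertices. -/
noncomputable def graphRadius {V : Type*} [Fintype V] (G : SimpleGraph V) : ℕ :=
  sInf (Set.range (eccentricity G))

/-- The diameter of a graph: the maximum distance over all pairs of vertices. -/
noncomputable def graphDiameter {V : Type*} [Fintype V] (G : SimpleGraph V) : ℕ :=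
  Finset.univ.sup fun p : V × V => G.dist p.1 p.2

theorem mp_geod {V : Type*} (G : SimpleGraph V) (hG : G.Connected) (u v : V) :
    ∃ p : ℕ → V, p 0 = u ∧ p (G.dist u v) = v ∧
      ∀ i j, i ≤ j → j ≤ G.dist u v → G.dist (p i) (p j) = j - i := by
  obtain ⟨w, hw⟩ := hG.exists_walk_length_eq_dist u v
  have h1 : ∀ i k, G.dist (w.getVert i) (w.getVert (i + k)) ≤ k := by
    intro i k
    induction k with
    | zero => simp
    | succ k ih =>
      have h2 : G.dist (w.getVert (i + k)) (w.getVert (i + (k + 1))) ≤ 1 := by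
        by_cases hk : i + k < w.length
        · exact le_of_eq (SimpleGraph.dist_eq_one_iff_adj.mpr (w.adj_getVert_succ hk))
        · rw [w.getVert_of_length_le (by omega), w.getVert_of_length_le (by omega)]
          simp
      have := hG.dist_triangle (u := w.getVert i) (v := w.getVert (i + k))
        (w := w.getVert (i + (k + 1)))
      omega
  refine ⟨w.getVert, by simp, by rw [← hw]; simp, ?_⟩
  intro i j hij hj
  have a := h1 0 i
  have b := h1 i (j - i)
  have c := h1 j (w.length - j)
  rw [show i + (j - i) = j by omega] at b
  rw [show j + (w.length - j) = w.length by omega] at c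
  simp only [zero_add, SimpleGraph.Walk.getVert_zero, SimpleGraph.Walk.getVert_length] at a c
  have t1 := hG.dist_triangle (u := u) (v := w.getVert i) (w := v)
  have t2 := hG.dist_triangle (u := w.getVert i) (v := w.getVert j) (w := v)
  omega

theorem mp_span (I : Finset ℕ) (h : I.Nonempty) :
    ∃ a ∈ I, ∃ b ∈ I, a ≤ b ∧ I.card ≤ b - a + 1 ∧ ∀ x ∈ I, a ≤ x ∧ x ≤ b := by
  refine ⟨I.min' h, I.min'_mem h, I.max' h, I.max'_mem h, I.min'_le_max' h, ?_,
    fun x hx => ⟨I.min'_le x hx, I.le_max' x hx⟩⟩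
  have : I ⊆ Finset.Icc (I.min' h) (I.max' h) := fun x hx =>
    Finset.mem_Icc.mpr ⟨I.min'_le x hx, I.le_max' x hx⟩
  have := Finset.card_le_card this
  rw [Nat.card_Icc] at this
  have := I.min'_le_max' h
  omega

theorem mp_key {V : Type*} [Fintype V] (G : SimpleGraph V) (hG : G.Connected)
    (p q : ℕ → V) (d r m n : ℕ) (hm : m = d / 2) (hn : n = d - d / 2)
    (hp : ∀ i j, i ≤ j → j ≤ d → G.dist (p i) (p j) = j - i)
    (hq : ∀ i j, i ≤ j → j ≤ r → G.dist (q i) (q j) = j - i)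
    (h0 : q 0 = p m) :
    (d / 3 + 1) + (r - (n + 3)) / 3 ≤ multipackingNumber G := by
  classical
  have hpq : ∀ i j, i ≤ d → j ≤ r → j ≤ G.dist (p i) (q j) + (i - m) + (m - i) := by
    intro i j hi hj
    have t := hG.dist_triangle (u := q 0) (v := p i) (w := q j)
    have e := hq 0 j (by omega) hj
    rw [h0] at t e
    rcases le_total i m with h | h
    · have := hp i m h (by omega)
      rw [G.dist_comm] at this
      omega
    · have := hp m i h hi
      omega
  set f : ℕ → V := fun a => p (3 * a) with hf
  set g : ℕ → V := fun b => q (3 * b + n + 6) with hg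
  set A := Finset.range (d / 3 + 1) with hA
  set B := Finset.range ((r - (n + 3)) / 3) with hB
  have hAm : ∀ a ∈ A, 3 * a ≤ d := by intro a ha; rw [hA, Finset.mem_range] at ha; omega
  have hBm : ∀ a ∈ B, 3 * a + n + 6 ≤ r := by
    intro a ha; rw [hB, Finset.mem_range] at ha; omega
  have ff : ∀ a ∈ A, ∀ b ∈ A, a ≤ b → G.dist (f a) (f b) = 3 * b - 3 * a := by
    intro a ha b hb hab
    exact hp _ _ (by omega) (hAm b hb)
  have gg : ∀ a ∈ B, ∀ b ∈ B, a ≤ b → G.dist (g a) (g b) = 3 * b - 3 * a := by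
    intro a ha b hb hab
    have := hq (3 * a + n + 6) (3 * b + n + 6) (by omega) (hBm b hb)
    simp only [hg]
    omega
  have fg : ∀ a ∈ A, ∀ b ∈ B,
      3 * b + n + 6 ≤ G.dist (f a) (g b) + (3 * a - m) + (m - 3 * a) := by
    intro a ha b hb
    exact hpq _ _ (hAm a ha) (hBm b hb)
  have fi : Set.InjOn f A := by
    intro a ha b hb hab
    rcases le_total a b with h | h
    · have := ff a ha b hb h
      rw [hab, SimpleGraph.dist_self] at this; omega
    · have := ff b hb a ha h
      rw [hab, SimpleGraph.dist_self] at this; omega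
  have gi : Set.InjOn g B := by
    intro a ha b hb hab
    rcases le_total a b with h | h
    · have := gg a ha b hb h
      rw [hab, SimpleGraph.dist_self] at this; omega
    · have := gg b hb a ha h
      rw [hab, SimpleGraph.dist_self] at this; omega
  have hdisj : Disjoint (A.image f) (B.image g) := by
    rw [Finset.disjoint_left]
    intro x hx hy
    obtain ⟨a, ha, rfl⟩ := Finset.mem_image.mp hx
    obtain ⟨b, hb, hab⟩ := Finset.mem_image.mp hy
    have := fg a ha b hb
    have h3 := hAm a ha
    rw [hab, SimpleGraph.dist_self] at this
    omega
  unfold multipackingNumber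
  apply le_csSup
  · refine ⟨Nat.card V, ?_⟩
    rintro _ ⟨P, -, rfl⟩
    exact Set.ncard_le_card P
  refine ⟨((A.image f ∪ B.image g : Finset V) : Set V), ?_, ?_⟩
  swap
  · rw [Set.ncard_coe_finset, Finset.card_union_of_disjoint hdisj,
      Finset.card_image_of_injOn fi, Finset.card_image_of_injOn gi]
    simp [hA, hB]
  intro x s hs
  set I := A.filter (fun a => G.dist (f a) x ≤ s) with hI
  set J := B.filter (fun a => G.dist (g a) x ≤ s) with hJ
  have hsub : {u ∈ ((A.image f ∪ B.image g : Finset V) : Set V) | G.dist u x ≤ s}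
      ⊆ ((I.image f ∪ J.image g : Finset V) : Set V) := by
    rintro u ⟨hu, hd⟩
    simp only [Finset.coe_union, Finset.coe_image, Set.mem_union, Set.mem_image,
      Finset.mem_coe] at hu ⊢
    rcases hu with ⟨a, ha, rfl⟩ | ⟨a, ha, rfl⟩
    · exact Or.inl ⟨a, Finset.mem_filter.mpr ⟨ha, hd⟩, rfl⟩
    · exact Or.inr ⟨a, Finset.mem_filter.mpr ⟨ha, hd⟩, rfl⟩
  have hcard : I.card + J.card ≤ s := by
    have tri : ∀ y z, G.dist y x ≤ s → G.dist z x ≤ s → G.dist y z ≤ 2 * s := by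
      intro y z hy hz
      have := hG.dist_triangle (u := y) (v := x) (w := z)
      rw [G.dist_comm (u := x)] at this
      omega
    have hi : I.card = 0 ∨ ∃ a ∈ I, ∃ b ∈ I, a ≤ b ∧ I.card ≤ b - a + 1 ∧ ∀ x ∈ I, a ≤ x ∧ x ≤ b := by
      rcases I.eq_empty_or_nonempty with h | h
      · left; simp [h]
      · right; exact mp_span I h
    have hj : J.card = 0 ∨ ∃ a ∈ J, ∃ b ∈ J, a ≤ b ∧ J.card ≤ b - a + 1 ∧ ∀ x ∈ J, a ≤ x ∧ x ≤ b := by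
      rcases J.eq_empty_or_nonempty with h | h
      · left; simp [h]
      · right; exact mp_span J h
    have hi' : ∀ a ∈ I, ∀ b ∈ I, a ≤ b → 3 * b - 3 * a ≤ 2 * s := by
      intro a ha b hb hab
      rw [hI, Finset.mem_filter] at ha hb
      rw [← ff a ha.1 b hb.1 hab]
      exact tri _ _ ha.2 hb.2
    have hj' : ∀ a ∈ J, ∀ b ∈ J, a ≤ b → 3 * b - 3 * a ≤ 2 * s := by
      intro a ha b hb hab
      rw [hJ, Finset.mem_filter] at ha hb
      rw [← gg a ha.1 b hb.1 hab]
      exact tri _ _ ha.2 hb.2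
    have hij : ∀ a ∈ I, ∀ b ∈ J,
        3 * a ≤ d ∧ 3 * b + n + 6 ≤ 2 * s + (3 * a - m) + (m - 3 * a) := by
      intro a ha b hb
      rw [hI, Finset.mem_filter] at ha
      rw [hJ, Finset.mem_filter] at hb
      have := fg a ha.1 b hb.1
      have := tri _ _ ha.2 hb.2
      exact ⟨hAm a ha.1, by omega⟩
    rcases hi with hi | ⟨a, ha, b, hb, hab, hi, hlo⟩
    · rcases hj with hj | ⟨a', ha', b', hb', hab', hj, -⟩
      · omega
      · have := hj' a' ha' b' hb' hab'
        omega
    · have h1 := hi' a ha b hb hab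
      rcases hj with hj | ⟨a', ha', b', hb', hab', hj, -⟩
      · omega
      · have h2 := hj' a' ha' b' hb' hab'
        have h3 := hij a ha b' hb'
        have h4 := hij b hb b' hb'
        clear_value I J A B f g
        have hall : ∀ x ∈ I, 3 * b' + n + 6 ≤ 2 * s + (3 * x - m) + (m - 3 * x) :=
          fun x hx => (hij x hx b' hb').2
        rcases le_total m (3 * a) with h | h
        · omega
        rcases le_total (3 * b) m with h' | h'
        · omega
        rcases le_or_gt (3 * b' + n + 6) (2 * s) with h5 | h5
        · omega
        obtain ⟨e, he⟩ : ∃ e, 3 * b' + n + 6 = 2 * s + e := ⟨_, (Nat.add_sub_cancel' h5.le).symm⟩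
        have hsubI : I ⊆ Finset.Icc a ((m - e) / 3) ∪ Finset.Icc ((m + e + 2) / 3) b := by
          intro x hx
          have h6 := hall x hx
          have h7 := hlo x hx
          rw [Finset.mem_union, Finset.mem_Icc, Finset.mem_Icc]
          rcases le_total m (3 * x) with h8 | h8
          · right; omega
          · left; omega
        have h9 := (Finset.card_le_card hsubI).trans (Finset.card_union_le _ _)
        rw [Nat.card_Icc, Nat.card_Icc] at h9
        have h10 : 3 * I.card + 2 * e + 3 * a ≤ 3 * b + 6 := by omega
        have h11 : 3 * b ≤ 3 * a + 2 * s := by omega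
        have h12 : 3 * J.card ≤ 3 * b' - 3 * a' + 3 := by omega
        have h13 : 3 * b ≤ 2 * n := by omega
        have h14 : 3 * I.card + 3 * J.card ≤ 3 * s + 2 := by
          clear h9 hi hj
          omega
        omega
  calc _ ≤ _ := Set.ncard_le_ncard hsub (Finset.finite_toSet _)
    _ ≤ _ := by
      rw [Set.ncard_coe_finset]
      exact (Finset.card_union_le _ _).trans
        (add_le_add Finset.card_image_le Finset.card_image_le)
    _ ≤ s := hcard

/-- For every finite connected nonempty simple graph `G` of diameter `d` and radius `r`,
`mp(G) ≥ d/6 + r/3 − 3/2`, equivalently `6·mp(G) ≥ d + 2r − 9`. -/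
theorem six_mul_multipacking_ge_diam_add_two_radius_sub_nine
    {V : Type*} [Fintype V] [Nonempty V] (G : SimpleGraph V) (hG : G.Connected) :
    (graphDiameter G : ℤ) + 2 * (graphRadius G : ℤ) - 9
      ≤ 6 * (multipackingNumber G : ℤ) := by
  obtain ⟨⟨a, b⟩, -, hab⟩ := Finset.exists_mem_eq_sup (Finset.univ : Finset (V × V))
    Finset.univ_nonempty (fun p : V × V => G.dist p.1 p.2)
  change graphDiameter G = G.dist a b at hab
  obtain ⟨p, -, -, hp⟩ := mp_geod G hG a b
  rw [← hab] at hp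
  set c := p (graphDiameter G / 2) with hc
  obtain ⟨w, -, hw⟩ := Finset.exists_mem_eq_sup (Finset.univ : Finset V)
    Finset.univ_nonempty (fun u : V => G.dist u c)
  change eccentricity G c = G.dist w c at hw
  have hr : graphRadius G ≤ eccentricity G c := Nat.sInf_le ⟨c, rfl⟩
  obtain ⟨q, hq0, -, hq⟩ := mp_geod G hG c w
  rw [G.dist_comm, ← hw] at hq
  have := mp_key G hG p q (graphDiameter G) (graphRadius G) _ _ rfl rfl hp
    (fun i j h1 h2 => hq i j h1 (h2.trans hr)) (hq0.trans hc)
  omega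
end

section
/- Let G be a finite connected nonempty simple graph in which every vertex has eccentricity at least 7. Then mp(G) ≥ 4. -/
theorem exists_split_dist {V : Type*} (G : SimpleGraph V) (hG : G.Connected) (a b : V) (k : ℕ)
    (hk : k ≤ G.dist a b) : ∃ c, G.dist a c = k ∧ G.dist c b = G.dist a b - k := by
  obtain ⟨p, hp⟩ := hG.exists_walk_length_eq_dist a b
  refine ⟨p.getVert k, ?_⟩
  have h1 := SimpleGraph.dist_le (p.take k)
  have h2 := SimpleGraph.dist_le (p.drop k)
  have h3 := hG.dist_triangle (u := a) (v := p.getVert k) (w := b)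
  rw [SimpleGraph.Walk.take_length] at h1
  rw [SimpleGraph.Walk.drop_length] at h2
  omega

theorem exists_far {V : Type*} [Fintype V] [Nonempty V] (G : SimpleGraph V)
    (h : ∀ v : V, 7 ≤ eccentricity G v) (v : V) : ∃ u, 7 ≤ G.dist u v := by
  have := h v
  unfold eccentricity at this
  obtain ⟨u, -, hu⟩ := (Finset.le_sup_iff (by simp)).1 this
  exact ⟨u, hu⟩

/-- If every vertex of `G` has eccentricity at least `7`, then `mp(G) ≥ 4`. -/
theorem multipacking_ge_four_of_eccentricity_ge_seven
    {V : Type*} [Fintype V] [Nonempty V] (G : SimpleGraph V) (hG : G.Connected)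
    (h : ∀ v : V, 7 ≤ eccentricity G v) :
    4 ≤ multipackingNumber G := by
  classical
  obtain ⟨a⟩ := ‹Nonempty V›
  haveI : Nonempty V := ⟨a⟩
  obtain ⟨z, hz⟩ := exists_far G h a
  rw [SimpleGraph.dist_comm] at hz
  obtain ⟨c, hac, -⟩ := exists_split_dist G hG a z 6 (by omega)
  obtain ⟨m, ham, hmc⟩ := exists_split_dist G hG a c 3 (by omega)
  obtain ⟨w, hw⟩ := exists_far G h m
  have tri : ∀ x y v : V, G.dist x y ≤ G.dist x v + G.dist y v := fun x y v => by
    have := hG.dist_triangle (u := x) (v := v) (w := y)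
    rwa [SimpleGraph.dist_comm (u := v) (v := y)] at this
  have hmc' : G.dist m c = 3 := by omega
  have hwa := tri w m a
  rw [SimpleGraph.dist_comm (u := m) (v := a)] at hwa
  have hwc := tri w m c
  have ne : ∀ x y : V, G.dist x y ≠ 0 → x ≠ y := by
    rintro x y hxy rfl
    simp at hxy
  have n1 : a ≠ m := ne _ _ (by omega)
  have n2 : a ≠ c := ne _ _ (by omega)
  have n3 : m ≠ c := ne _ _ (by omega)
  have n4 : w ≠ a := ne _ _ (by omega)
  have n5 : w ≠ m := ne _ _ (by omega)
  have n6 : w ≠ c := ne _ _ (by omega)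
  unfold multipackingNumber
  apply le_csSup
  · refine ⟨Fintype.card V, ?_⟩
    rintro n ⟨P, -, rfl⟩
    rw [← Nat.card_eq_fintype_card]
    exact Set.ncard_le_card P
  · refine ⟨((({w, a, m, c} : Finset V)) : Set V), ?_, ?_⟩
    · intro v r hr
      have e : {u ∈ ((({w, a, m, c} : Finset V)) : Set V) | G.dist u v ≤ r}
          = (((({w, a, m, c} : Finset V)).filter fun u => G.dist u v ≤ r) : Set V) := by
        ext u; simp
      rw [e, Set.ncard_coe_finset, Finset.card_filter, Finset.sum_insert (by simp [n4, n5, n6]),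
        Finset.sum_insert (by simp [n1, n2]), Finset.sum_insert (by simp [n3]),
        Finset.sum_singleton]
      have t1 := tri a m v
      have t2 := tri a c v
      have t3 := tri m c v
      have t4 := tri w a v
      have t5 := tri w m v
      have t6 := tri w c v
      split_ifs <;> omega
    · rw [Set.ncard_coe_finset]
      simp [n1, n2, n3, n4, n5, n6]
end
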